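/- Fix n ≥ 1 and ε ≥ 0. For each f ∈ 𝓕ₙ write f = f̄ + δᶠ·x, where f̄ ∈ 𝓕ₙ has no degree-1 terms (its degree-2 and degree-3 terms agree with f) and δᶠ ∈ 𝔽₂ⁿ records the degree-1 coefficients (so f(x) = f̄(x) + ∑ᵢ δᶠᵢ xᵢ). For each such f̄ define the true probabilities Q_{f̄}(z) = (gap(f̄ + z·x)/2ⁿ)² for z ∈ 𝔽₂ⁿ, and suppose P_{f̄} : 𝔽₂ⁿ → ℝ≥0 satisfies ∑_{z ∈ 𝔽₂ⁿ} |P_{f̄}(z) − Q_{f̄}(z)| ≤ ε. Define 𝒜(f) = 1 if either (gap(f)² ≥ 2^{n−1} and P_{f̄}(δᶠ) ≥ (5/6)·2^{−n−1}) or (gap(f)² ≤ 2^{n−2} and P_{f̄}(δᶠ) ≤ (2/3)·2^{−n−1}), and 𝒜(f) = 0 otherwise. Then the fraction of f ∈ 𝓕ₙ^prom with 𝒜(f) = 1 is at least 1 − 60ε. -/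

import Mathlib

/-- The gap of a Boolean function on a finite domain:
`gap f = ∑_x (−1)^{f(x)}`, i.e. `+1` for each `x` with `f x = 0` and `−1` otherwise. -/
def gap {σ : Type*} [Fintype σ] (f : σ → ZMod 2) : ℤ :=
  ∑ x : σ, if f x = 0 then 1 else -1

/-- Index set of monomials of a degree-≤3 polynomial over 𝔽₂ in `n` variables with no
constant term: nonempty subsets of the variables of size at most 3. -/
abbrev MonIdx (n : ℕ) := {S : Finset (Fin n) // S.Nonempty ∧ S.card ≤ 3}

/-- A coefficient assignment, i.e. an element of 𝓕ₙ: a polynomial over 𝔽₂ in `n` variables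
of total degree ≤ 3 with zero constant term, recorded by its (multilinear) coefficients. -/
abbrev Coeffs (n : ℕ) := MonIdx n → ZMod 2

/-- The Boolean function `𝔽₂ⁿ → 𝔽₂` evaluated by the polynomial with coefficients `α`. -/
def polyFun {n : ℕ} (α : Coeffs n) : (Fin n → ZMod 2) → ZMod 2 :=
  fun z => ∑ S : MonIdx n, α S * ∏ i ∈ S.1, z i

/-- The monomial index of the degree-1 monomial `x_i`. -/
def deltaIdx {n : ℕ} (i : Fin n) : MonIdx n :=
  ⟨{i}, Finset.singleton_nonempty i, by simp⟩

/-- `bar α`: the same polynomial with all degree-1 coefficients set to zero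
(degree-2 and degree-3 terms unchanged). -/
def bar {n : ℕ} (α : Coeffs n) : Coeffs n :=
  fun S => if S.1.card = 1 then 0 else α S

/-- `delta α ∈ 𝔽₂ⁿ`: the vector of degree-1 coefficients of the polynomial `α`,
so that `polyFun α x = polyFun (bar α) x + ∑ᵢ (delta α)ᵢ xᵢ`. -/
def delta {n : ℕ} (α : Coeffs n) : Fin n → ZMod 2 :=
  fun i => α (deltaIdx i)

/-- The Boolean function `f̄ + z·x` obtained from the polynomial `β` by adding the linear
form `z·x`. -/
def shift {n : ℕ} (β : Coeffs n) (z : Fin n → ZMod 2) : (Fin n → ZMod 2) → ZMod 2 :=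
  fun y => polyFun β y + ∑ i, z i * y i

/-- The true output distribution of the IQP circuit `C_{f̄}`:
`Q_{f̄}(z) = (gap(f̄ + z·x)/2ⁿ)²`. -/
noncomputable def Qtrue {n : ℕ} (β : Coeffs n) (z : Fin n → ZMod 2) : ℝ :=
  ((gap (shift β z) : ℝ) / 2 ^ n) ^ 2

section BooleanSign

/-- The sign `(−1)^v` of `v ∈ 𝔽₂`. -/
def sgn (v : ZMod 2) : ℤ := if v = 0 then 1 else -1

theorem sgn_add : ∀ a b : ZMod 2, sgn (a + b) = sgn a * sgn b := by decide

theorem sgn_sq : ∀ a : ZMod 2, sgn a ^ 2 = 1 := by decide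

theorem gap_eq_sum_sgn {σ : Type*} [Fintype σ] (f : σ → ZMod 2) :
    gap f = ∑ x, sgn (f x) := rfl

theorem even_gap {n : ℕ} (hn : 1 ≤ n) (f : (Fin n → ZMod 2) → ZMod 2) : Even (gap f) := by
  have hcast : ((gap f : ℤ) : ZMod 2) = 0 := by
    have hs : ∀ v : ZMod 2, ((sgn v : ℤ) : ZMod 2) = 1 := by decide
    rw [gap_eq_sum_sgn, Int.cast_sum, Finset.sum_congr rfl fun x _ => hs (f x)]
    have h2 : (2 : ZMod 2) = 0 := by decide
    simp [h2, show n ≠ 0 by omega]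
  exact (ZMod.intCast_eq_zero_iff_even).1 hcast

end BooleanSign

section Coefficients

variable {n : ℕ}

theorem polyFun_add (α β : Coeffs n) (x : Fin n → ZMod 2) :
    polyFun (α + β) x = polyFun α x + polyFun β x := by
  simp [polyFun, add_mul, Finset.sum_add_distrib]

theorem polyFun_sum {ι : Type*} (s : Finset ι) (α : ι → Coeffs n) (x : Fin n → ZMod 2) :
    polyFun (∑ k ∈ s, α k) x = ∑ k ∈ s, polyFun (α k) x := by
  simp only [polyFun, Finset.sum_apply, Finset.sum_mul]
  exact Finset.sum_comm

theorem polyFun_single (S : MonIdx n) (c : ZMod 2) (x : Fin n → ZMod 2) :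
    polyFun (Pi.single S c) x = c * ∏ i ∈ S.1, x i := by
  unfold polyFun
  rw [Finset.sum_eq_single S]
  · simp
  · intro T _ h
    simp [h]
  · simp

/-- The linear form `z·x` as an element of `𝓕ₙ`. -/
def linCoeffs (z : Fin n → ZMod 2) : Coeffs n := ∑ i, Pi.single (deltaIdx i) (z i)

theorem polyFun_linCoeffs (z y : Fin n → ZMod 2) :
    polyFun (linCoeffs z) y = ∑ i, z i * y i := by
  simp [linCoeffs, polyFun_sum, polyFun_single, deltaIdx]

theorem deltaIdx_injective : Function.Injective (deltaIdx (n := n)) := by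
  intro i j h
  simpa [deltaIdx] using h

theorem linCoeffs_deltaIdx (z : Fin n → ZMod 2) (j : Fin n) :
    linCoeffs z (deltaIdx j) = z j := by
  rw [linCoeffs, Finset.sum_apply, Finset.sum_eq_single j]
  · simp
  · intro i _ h
    exact Pi.single_eq_of_ne (fun h' => h (deltaIdx_injective h').symm) _
  · simp

theorem linCoeffs_of_card_ne_one (z : Fin n → ZMod 2) {S : MonIdx n} (hS : S.1.card ≠ 1) :
    linCoeffs z S = 0 := by
  rw [linCoeffs, Finset.sum_apply]
  refine Finset.sum_eq_zero fun i _ => Pi.single_eq_of_ne ?_ _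
  rintro rfl
  simp [deltaIdx] at hS

theorem bar_bar (α : Coeffs n) : bar (bar α) = bar α := by
  funext S
  by_cases h : S.1.card = 1 <;> simp [bar, h]

theorem bar_add_linCoeffs (α : Coeffs n) (z : Fin n → ZMod 2) :
    bar (α + linCoeffs z) = bar α := by
  funext S
  by_cases h : S.1.card = 1
  · simp [bar, h]
  · simp [bar, h, linCoeffs_of_card_ne_one z h]

theorem delta_add_linCoeffs (α : Coeffs n) (z : Fin n → ZMod 2) :
    delta (α + linCoeffs z) = delta α + z := by
  funext i
  simp [delta, linCoeffs_deltaIdx]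

theorem bar_add_linCoeffs_delta (α : Coeffs n) : bar α + linCoeffs (delta α) = α := by
  funext S
  by_cases h : S.1.card = 1
  · obtain ⟨i, hi⟩ := Finset.card_eq_one.1 h
    obtain rfl : S = deltaIdx i := Subtype.ext hi
    rw [Pi.add_apply, linCoeffs_deltaIdx, bar, if_pos h, zero_add]
    rfl
  · simp [bar, h, linCoeffs_of_card_ne_one _ h]

theorem shift_bar_delta (α : Coeffs n) : shift (bar α) (delta α) = polyFun α := by
  funext y
  rw [shift, ← polyFun_linCoeffs, ← polyFun_add, bar_add_linCoeffs_delta]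

/-- Averaging over the linear part turns a bound for every degree-1-free `f̄` into a bound over
all of `𝓕ₙ`. -/
theorem two_pow_mul_sum_bar_delta_le (F : Coeffs n → (Fin n → ZMod 2) → ℝ) (ε : ℝ)
    (hF : ∀ β : Coeffs n, bar β = β → ∑ z, F β z ≤ ε) :
    2 ^ n * ∑ α : Coeffs n, F (bar α) (delta α) ≤ Fintype.card (Coeffs n) * ε := by
  have hshift : ∀ z : Fin n → ZMod 2,
      ∑ α : Coeffs n, F (bar α) (delta α + z) = ∑ α : Coeffs n, F (bar α) (delta α) := by
    intro z
    rw [← Equiv.sum_comp (Equiv.addRight (linCoeffs z)) fun α => F (bar α) (delta α)]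
    simp [bar_add_linCoeffs, delta_add_linCoeffs]
  calc 2 ^ n * ∑ α : Coeffs n, F (bar α) (delta α)
      = ∑ z : Fin n → ZMod 2, ∑ α : Coeffs n, F (bar α) (delta α + z) := by
        simp [hshift]
    _ = ∑ α : Coeffs n, ∑ z, F (bar α) z := by
        rw [Finset.sum_comm]
        refine Finset.sum_congr rfl fun α _ => ?_
        exact Equiv.sum_comp (Equiv.addLeft (delta α)) (F (bar α))
    _ ≤ ∑ _α : Coeffs n, ε := Finset.sum_le_sum fun α _ => hF _ (bar_bar α)
    _ = Fintype.card (Coeffs n) * ε := by simp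

end Coefficients

section Restriction

variable {n : ℕ} (i : Fin n)

/-- Nonempty sets of at most two variables other than `x_i`. -/
abbrev QuadIdx := {T : Finset (Fin n) // T.Nonempty ∧ T.card ≤ 2 ∧ i ∉ T}

/-- Polynomials of degree at most 2 with zero constant term not involving `x_i`. -/
abbrev Quad := QuadIdx i → ZMod 2

variable {i}

/-- The quadratic polynomial `γ` as an element of `𝓕ₙ`. -/
def quadCoeffs (γ : Quad i) : Coeffs n :=
  ∑ T : QuadIdx i, Pi.single ⟨T.1, T.2.1, T.2.2.1.trans (by norm_num)⟩ (γ T)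

/-- The cubic polynomial `x_i γ` as an element of `𝓕ₙ`. -/
def mulVarCoeffs (γ : Quad i) : Coeffs n :=
  ∑ T : QuadIdx i, Pi.single ⟨insert i T.1, Finset.insert_nonempty _ _,
    (Finset.card_insert_le _ _).trans (Nat.succ_le_succ T.2.2.1)⟩ (γ T)

theorem polyFun_quadCoeffs (γ : Quad i) (x : Fin n → ZMod 2) :
    polyFun (quadCoeffs γ) x = ∑ T, γ T * ∏ j ∈ T.1, x j := by
  simp [quadCoeffs, polyFun_sum, polyFun_single]

theorem polyFun_mulVarCoeffs (γ : Quad i) (x : Fin n → ZMod 2) :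
    polyFun (mulVarCoeffs γ) x = x i * polyFun (quadCoeffs γ) x := by
  rw [polyFun_quadCoeffs, mulVarCoeffs, polyFun_sum, Finset.mul_sum]
  refine Finset.sum_congr rfl fun T _ => ?_
  rw [polyFun_single, Finset.prod_insert T.2.2.2]
  ring

theorem polyFun_quadCoeffs_add (γ γ' : Quad i) (x : Fin n → ZMod 2) :
    polyFun (quadCoeffs (γ + γ')) x = polyFun (quadCoeffs γ) x + polyFun (quadCoeffs γ') x := by
  simp [polyFun_quadCoeffs, add_mul, Finset.sum_add_distrib]

theorem prod_update_of_notMem {T : Finset (Fin n)} (hT : i ∉ T) (x : Fin n → ZMod 2)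
    (v : ZMod 2) : ∏ j ∈ T, Function.update x i v j = ∏ j ∈ T, x j :=
  Finset.prod_congr rfl fun _ hj => Function.update_of_ne (ne_of_mem_of_not_mem hj hT) _ _

theorem polyFun_quadCoeffs_update (γ : Quad i) (x : Fin n → ZMod 2) (v : ZMod 2) :
    polyFun (quadCoeffs γ) (Function.update x i v) = polyFun (quadCoeffs γ) x := by
  simp only [polyFun_quadCoeffs]
  exact Finset.sum_congr rfl fun T _ => by rw [prod_update_of_notMem T.2.2.2]

theorem exists_quad_monomial_update (i : Fin n) (S : MonIdx n) :
    ∃ (q : Quad i) (c : ZMod 2), ∀ x : Fin n → ZMod 2, x i = 0 →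
      ∏ j ∈ S.1, Function.update x i 1 j =
        ∏ j ∈ S.1, x j + polyFun (quadCoeffs q) x + c := by
  by_cases hi : i ∈ S.1
  · have hprod : ∀ x : Fin n → ZMod 2, x i = 0 →
        ∏ j ∈ S.1, x j = 0 ∧
          ∏ j ∈ S.1, Function.update x i 1 j = ∏ j ∈ S.1.erase i, x j := by
      intro x hx
      refine ⟨Finset.prod_eq_zero hi hx, ?_⟩
      rw [← Finset.mul_prod_erase _ _ hi, prod_update_of_notMem (Finset.notMem_erase _ _)]
      simp
    by_cases hne : (S.1.erase i).Nonempty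
    · let T : QuadIdx i := ⟨S.1.erase i, hne, by
        have := Finset.card_erase_of_mem hi
        have := S.2.2
        omega, Finset.notMem_erase _ _⟩
      refine ⟨Pi.single T 1, 0, fun x hx => ?_⟩
      rw [(hprod x hx).1, (hprod x hx).2, polyFun_quadCoeffs, Finset.sum_eq_single T]
      · simp [T]
      · intro T' _ h
        simp [h]
      · simp
    · rw [Finset.not_nonempty_iff_eq_empty] at hne
      refine ⟨0, 1, fun x hx => ?_⟩
      rw [(hprod x hx).1, (hprod x hx).2, hne, polyFun_quadCoeffs]
      simp
  · refine ⟨0, 0, fun x _ => ?_⟩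
    rw [prod_update_of_notMem hi, polyFun_quadCoeffs]
    simp

theorem exists_quad_polyFun_update (i : Fin n) (α : Coeffs n) :
    ∃ (q : Quad i) (c : ZMod 2), ∀ x : Fin n → ZMod 2, x i = 0 →
      polyFun α (Function.update x i 1) = polyFun α x + polyFun (quadCoeffs q) x + c := by
  choose q c h using exists_quad_monomial_update i
  refine ⟨∑ S, α S • q S, ∑ S, α S * c S, fun x hx => ?_⟩
  have hq : polyFun (quadCoeffs (∑ S, α S • q S)) x
      = ∑ S, α S * polyFun (quadCoeffs (q S)) x := by
    simp only [polyFun_quadCoeffs, Finset.sum_apply, Pi.smul_apply, smul_eq_mul,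
      Finset.sum_mul, Finset.mul_sum, mul_assoc]
    exact Finset.sum_comm
  rw [hq]
  simp only [polyFun, ← Finset.sum_add_distrib, ← mul_add]
  exact Finset.sum_congr rfl fun S _ => by rw [h S x hx]; rfl

/-- The part of the gap coming from the hyperplane `x_i = 0`. -/
def gapZero (i : Fin n) (α : Coeffs n) : ℤ :=
  ∑ x : Fin n → ZMod 2 with x i = 0, sgn (polyFun α x)

/-- The part of the gap coming from the hyperplane `x_i = 1`. -/
def gapOne (i : Fin n) (α : Coeffs n) : ℤ :=
  ∑ x : Fin n → ZMod 2 with x i = 0, sgn (polyFun α (Function.update x i 1))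

theorem gap_polyFun (i : Fin n) (α : Coeffs n) :
    gap (polyFun α) = gapZero i α + gapOne i α := by
  rw [gap_eq_sum_sgn, ← Finset.sum_filter_add_sum_filter_not Finset.univ fun x => x i = 0]
  refine congrArg₂ _ rfl ?_
  have h01 : ∀ v : ZMod 2, v ≠ 0 → v = 1 := by decide
  refine Finset.sum_nbij' (fun x => Function.update x i 0) (fun x => Function.update x i 1)
    ?_ ?_ ?_ ?_ ?_
  · simp
  · simp
  · intro x hx
    simp only [Finset.mem_filter] at hx
    simp [← h01 _ hx.2]
  · intro x hx
    simp only [Finset.mem_filter] at hx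
    simp [← hx.2]
  · intro x hx
    simp only [Finset.mem_filter] at hx
    simp [← h01 _ hx.2]

theorem gap_polyFun_add_single (i : Fin n) (α : Coeffs n) :
    gap (polyFun (α + Pi.single (deltaIdx i) 1)) = gapZero i α - gapOne i α := by
  have hτ : ∀ x : Fin n → ZMod 2,
      polyFun (α + Pi.single (deltaIdx i) 1) x = polyFun α x + x i := by
    intro x
    simp [polyFun_add, polyFun_single, deltaIdx]
  have h1 : sgn 1 = -1 := by decide
  rw [gap_polyFun i, sub_eq_add_neg, gapOne, gapOne, ← Finset.sum_neg_distrib]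
  refine congrArg₂ _ (Finset.sum_congr rfl fun x hx => ?_)
    (Finset.sum_congr rfl fun x _ => ?_)
  · rw [hτ, (Finset.mem_filter.1 hx).2, add_zero]
  · rw [hτ, sgn_add, Function.update_self, h1, mul_neg_one]

theorem gapZero_add (α : Coeffs n) (γ γ' : Quad i) :
    gapZero i (α + (quadCoeffs γ + mulVarCoeffs γ + mulVarCoeffs γ')) =
      gapZero i (α + quadCoeffs γ) := by
  refine Finset.sum_congr rfl fun x hx => ?_
  simp [polyFun_add, polyFun_mulVarCoeffs, (Finset.mem_filter.1 hx).2]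

theorem gapOne_add (α : Coeffs n) (γ γ' : Quad i) :
    gapOne i (α + (quadCoeffs γ + mulVarCoeffs γ + mulVarCoeffs γ')) =
      gapOne i (α + mulVarCoeffs γ') := by
  refine Finset.sum_congr rfl fun x _ => ?_
  simp [polyFun_add, polyFun_mulVarCoeffs, CharTwo.add_self_eq_zero]

/-- The restrictions to the two hyperplanes run through the same family of polynomials, up to
sign. -/
theorem exists_gapOne_sq_eq_gapZero_sq (i : Fin n) (α : Coeffs n) :
    ∃ q : Quad i, ∀ γ : Quad i,
      gapOne i (α + mulVarCoeffs γ) ^ 2 = gapZero i (α + quadCoeffs (γ + q)) ^ 2 := by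
  obtain ⟨q, c, h⟩ := exists_quad_polyFun_update i α
  refine ⟨q, fun γ => ?_⟩
  have hc : gapOne i (α + mulVarCoeffs γ) = gapZero i (α + quadCoeffs (γ + q)) * sgn c := by
    rw [gapZero, Finset.sum_mul]
    refine Finset.sum_congr rfl fun x hx => ?_
    rw [← sgn_add, polyFun_add, polyFun_add, polyFun_mulVarCoeffs, polyFun_quadCoeffs_update,
      polyFun_quadCoeffs_add, h x (Finset.mem_filter.1 hx).2, Function.update_self]
    congr 1
    ring
  rw [hc, mul_pow, sgn_sq, mul_one]

/-- Conditionally on the cubic part, the gaps on the two hyperplanes are independent and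
identically distributed up to sign, so every function of their squares is nonnegatively
correlated. -/
theorem sum_mul_gapZero_gapOne_nonneg (i : Fin n) (h : ℤ → ℤ) :
    0 ≤ ∑ α : Coeffs n, h (gapZero i α ^ 2) * h (gapOne i α ^ 2) := by
  have hshift : ∀ γ γ' : Quad i,
      ∑ α : Coeffs n, h (gapZero i (α + quadCoeffs γ) ^ 2) *
        h (gapOne i (α + mulVarCoeffs γ') ^ 2) =
      ∑ α : Coeffs n, h (gapZero i α ^ 2) * h (gapOne i α ^ 2) := by
    intro γ γ'
    rw [← Equiv.sum_comp
      (Equiv.addRight (quadCoeffs γ + mulVarCoeffs γ + mulVarCoeffs γ'))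
      fun α => h (gapZero i α ^ 2) * h (gapOne i α ^ 2)]
    simp only [Equiv.coe_addRight, gapZero_add, gapOne_add]
  have hsq : ∀ α : Coeffs n,
      0 ≤ ∑ γ : Quad i, ∑ γ' : Quad i, h (gapZero i (α + quadCoeffs γ) ^ 2) *
        h (gapOne i (α + mulVarCoeffs γ') ^ 2) := by
    intro α
    obtain ⟨q, hq⟩ := exists_gapOne_sq_eq_gapZero_sq i α
    simp only [hq]
    rw [← Finset.sum_mul_sum, ← Equiv.sum_comp (Equiv.addRight q)
      fun γ => h (gapZero i (α + quadCoeffs γ) ^ 2)]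
    exact mul_self_nonneg _
  have htotal : 0 ≤ ∑ γ : Quad i, ∑ γ' : Quad i,
      ∑ α : Coeffs n, h (gapZero i α ^ 2) * h (gapOne i α ^ 2) := by
    refine (Finset.univ.sum_nonneg fun α _ => hsq α).trans_eq (Finset.sum_comm.trans ?_)
    refine Finset.sum_congr rfl fun γ _ => Finset.sum_comm.trans ?_
    exact Finset.sum_congr rfl fun γ' _ => hshift γ γ'
  have hcard : 0 < (Fintype.card (Quad i) : ℤ) := by exact_mod_cast Fintype.card_pos
  simp only [Finset.sum_const, Finset.card_univ, nsmul_eq_mul] at htotal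
  exact nonneg_of_mul_nonneg_right (nonneg_of_mul_nonneg_right htotal hcard) hcard

end Restriction

theorem sq_lt_iff_not_sq_lt_of_window {A B m : ℤ} (hp : m < (A + B) ^ 2)
    (hp' : (A + B) ^ 2 < 2 * m) (hm : m < (A - B) ^ 2) (hm' : (A - B) ^ 2 < 2 * m) :
    m < A ^ 2 ↔ ¬ m < B ^ 2 := by
  have hsum : A ^ 2 + B ^ 2 < 2 * m := by nlinarith
  constructor
  · intro h h'
    linarith
  · intro h
    by_contra h'
    rcases le_total 0 (A * B) with hAB | hAB <;> nlinarith [sq_nonneg (A + B), sq_nonneg (A - B)]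

/-- At most three quarters of the polynomials in `𝓕ₙ` have squared gap inside `(m, 2m)`. -/
theorem four_mul_card_gap_window_le {n : ℕ} (i : Fin n) (m : ℤ) :
    4 * (Finset.univ.filter fun α : Coeffs n =>
      m < gap (polyFun α) ^ 2 ∧ gap (polyFun α) ^ 2 < 2 * m).card ≤
      3 * Fintype.card (Coeffs n) := by
  let w : ℤ → ℤ := fun g => if m < g ^ 2 ∧ g ^ 2 < 2 * m then 1 else 0
  let h : ℤ → ℤ := fun s => if m < s then 1 else -1
  have hcount : ((Finset.univ.filter fun α : Coeffs n =>
      m < gap (polyFun α) ^ 2 ∧ gap (polyFun α) ^ 2 < 2 * m).card : ℤ) =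
      ∑ α : Coeffs n, w (gap (polyFun α)) := by
    simp [w]
  have hflip : ∑ α : Coeffs n, w (gapZero i α - gapOne i α) =
      ∑ α : Coeffs n, w (gap (polyFun α)) := by
    rw [← Equiv.sum_comp (Equiv.addRight (Pi.single (deltaIdx i) 1))
      fun α : Coeffs n => w (gap (polyFun α))]
    simp only [Equiv.coe_addRight, gap_polyFun_add_single]
  have hpoint : ∀ A B : ℤ,
      2 * w (A + B) + 2 * w (A - B) + h (A ^ 2) * h (B ^ 2) ≤ 3 := by
    intro A B
    by_cases hp : m < (A + B) ^ 2 ∧ (A + B) ^ 2 < 2 * m <;>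
    by_cases hm : m < (A - B) ^ 2 ∧ (A - B) ^ 2 < 2 * m
    · have := sq_lt_iff_not_sq_lt_of_window hp.1 hp.2 hm.1 hm.2
      simp only [w, h, if_pos hp, if_pos hm]
      by_cases hB : m < B ^ 2 <;> simp [this, hB]
    · simp only [w, h, if_pos hp, if_neg hm]
      split_ifs <;> norm_num
    · simp only [w, h, if_neg hp, if_pos hm]
      split_ifs <;> norm_num
    · simp only [w, h, if_neg hp, if_neg hm]
      split_ifs <;> norm_num
  have hsum := Finset.sum_le_sum fun (α : Coeffs n) (_ : α ∈ Finset.univ) =>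
    hpoint (gapZero i α) (gapOne i α)
  rw [Finset.sum_add_distrib, Finset.sum_add_distrib, ← Finset.mul_sum, ← Finset.mul_sum,
    hflip] at hsum
  simp only [← gap_polyFun, ← hcount, Finset.sum_const, Finset.card_univ, nsmul_eq_mul] at hsum
  have := sum_mul_gapZero_gapOne_nonneg i h
  zify
  linarith

/-- At least a quarter of the polynomials in `𝓕ₙ` satisfy the promise. -/
theorem card_le_four_mul_card_promise {n : ℕ} (hn : 1 ≤ n) :
    Fintype.card (Coeffs n) ≤ 4 * (Finset.univ.filter fun α : Coeffs n =>
      2 ^ (n - 1) ≤ gap (polyFun α) ^ 2 ∨ gap (polyFun α) ^ 2 ≤ 2 ^ (n - 2)).card := by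
  have hwindow := four_mul_card_gap_window_le (⟨0, hn⟩ : Fin n) (2 ^ (n - 2))
  have hsplit := Finset.card_filter_add_card_filter_not (s := (Finset.univ : Finset (Coeffs n)))
    fun α => 2 ^ (n - 1) ≤ gap (polyFun α) ^ 2 ∨ gap (polyFun α) ^ 2 ≤ 2 ^ (n - 2)
  have hsub := Finset.card_le_card (Finset.monotone_filter_right
    (p := fun α : Coeffs n =>
      ¬ (2 ^ (n - 1) ≤ gap (polyFun α) ^ 2 ∨ gap (polyFun α) ^ 2 ≤ 2 ^ (n - 2)))
    (q := fun α : Coeffs n => 2 ^ (n - 2) < gap (polyFun α) ^ 2 ∧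
      gap (polyFun α) ^ 2 < 2 * 2 ^ (n - 2)) Finset.univ (by
    intro α _ hα
    push Not at hα
    refine ⟨hα.2, hα.1.trans_le ?_⟩
    rw [← pow_succ']
    exact pow_le_pow_right₀ (by norm_num) (by omega)))
  rw [Finset.card_univ] at hsplit
  omega

theorem four_mul_gap_sq_le {n : ℕ} (hn : 1 ≤ n) {f : (Fin n → ZMod 2) → ZMod 2}
    (hf : gap f ^ 2 ≤ 2 ^ (n - 2)) : 4 * gap f ^ 2 ≤ 2 ^ n := by
  obtain rfl | h2 := hn.eq_or_lt
  · obtain ⟨k, hk⟩ := even_gap le_rfl f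
    have hk0 : k = 0 := by
      rw [hk] at hf
      have := abs_le.1 (sq_le_one_iff_abs_le_one _ |>.1 hf)
      omega
    simp [hk, hk0]
  · have : (2 : ℤ) ^ n = 4 * 2 ^ (n - 2) := by
      rw [show n = n - 2 + 2 by omega, pow_add]
      norm_num [mul_comm]
    linarith

/-- A failure of the test forces a large deviation of `P_{f̄}` from `Q_{f̄}`. -/
theorem one_le_mul_abs_sub_Qtrue {n : ℕ} (hn : 1 ≤ n) (α : Coeffs n) (p : ℝ)
    (hprom : 2 ^ (n - 1) ≤ gap (polyFun α) ^ 2 ∨ gap (polyFun α) ^ 2 ≤ 2 ^ (n - 2))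
    (hfail : ¬ ((2 ^ (n - 1) ≤ gap (polyFun α) ^ 2 ∧ (5 / 6) * ((2 : ℝ) ^ (n + 1))⁻¹ ≤ p) ∨
      (gap (polyFun α) ^ 2 ≤ 2 ^ (n - 2) ∧ p ≤ (2 / 3) * ((2 : ℝ) ^ (n + 1))⁻¹))) :
    1 ≤ 12 * 2 ^ n * |p - Qtrue (bar α) (delta α)| := by
  rw [Qtrue, shift_bar_delta]
  set g := gap (polyFun α)
  have hN : (0 : ℝ) < 2 ^ n := by positivity
  have hQ : 2 ^ n * ((g : ℝ) / 2 ^ n) ^ 2 = (g : ℝ) ^ 2 / 2 ^ n := by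
    field_simp
  have hinv : (2 : ℝ) ^ n * ((2 : ℝ) ^ (n + 1))⁻¹ = 1 / 2 := by
    rw [pow_succ]
    field_simp
  rw [not_or, not_and, not_and, not_le, not_le] at hfail
  rcases hprom with hbig | hsmall
  · have hp := mul_lt_mul_of_pos_left (hfail.1 hbig) hN
    have hg2 : (2 : ℤ) ^ n ≤ 2 * g ^ 2 := by
      calc (2 : ℤ) ^ n = 2 * 2 ^ (n - 1) := by rw [← pow_succ', Nat.sub_add_cancel hn]
        _ ≤ 2 * g ^ 2 := by linarith
    have hg2' : (2 : ℝ) ^ n ≤ 2 * (g : ℝ) ^ 2 := by exact_mod_cast hg2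
    have hX : 1 / 2 ≤ (g : ℝ) ^ 2 / 2 ^ n := by
      rw [le_div_iff₀ hN]
      linarith
    have := mul_le_mul_of_nonneg_left (neg_le_abs (p - ((g : ℝ) / 2 ^ n) ^ 2)) hN.le
    linarith
  · have hp := mul_lt_mul_of_pos_left (hfail.2 hsmall) hN
    have hg2' : 4 * (g : ℝ) ^ 2 ≤ (2 : ℝ) ^ n := by exact_mod_cast four_mul_gap_sq_le hn hsmall
    have hX : (g : ℝ) ^ 2 / 2 ^ n ≤ 1 / 4 := by
      rw [div_le_iff₀ hN]
      linarith
    have := mul_le_mul_of_nonneg_left (le_abs_self (p - ((g : ℝ) / 2 ^ n) ^ 2)) hN.le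
    linarith

open scoped Classical in
/-- if `P_{f̄}` is within additive (ℓ₁) error `ε` of `Q_{f̄}` for every
degree-1-free `f̄ ∈ 𝓕ₙ`, then the "SB test" `𝒜` succeeds on at least a `1 − 60ε` fraction
of the instances of `𝓕ₙ^prom`. -/
theorem stmt13 (n : ℕ) (hn : 1 ≤ n) (ε : ℝ) (hε : 0 ≤ ε)
    (P : Coeffs n → (Fin n → ZMod 2) → ℝ)
    (hP0 : ∀ β : Coeffs n, bar β = β → ∀ z, 0 ≤ P β z)
    (hP : ∀ β : Coeffs n, bar β = β →
      ∑ z : Fin n → ZMod 2, |P β z - Qtrue β z| ≤ ε) :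
    1 - 60 * ε ≤
      ((Finset.univ.filter
          (fun α : Coeffs n =>
            (2 ^ (n - 1) ≤ (gap (polyFun α)) ^ 2 ∨ (gap (polyFun α)) ^ 2 ≤ 2 ^ (n - 2)) ∧
            ((2 ^ (n - 1) ≤ (gap (polyFun α)) ^ 2 ∧
                (5 / 6) * ((2 : ℝ) ^ (n + 1))⁻¹ ≤ P (bar α) (delta α)) ∨
              ((gap (polyFun α)) ^ 2 ≤ 2 ^ (n - 2) ∧
                P (bar α) (delta α) ≤ (2 / 3) * ((2 : ℝ) ^ (n + 1))⁻¹)))).card : ℝ) /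
        ((Finset.univ.filter
          (fun α : Coeffs n =>
            2 ^ (n - 1) ≤ (gap (polyFun α)) ^ 2 ∨
              (gap (polyFun α)) ^ 2 ≤ 2 ^ (n - 2))).card) := by
  set prom : Coeffs n → Prop := fun α =>
    2 ^ (n - 1) ≤ (gap (polyFun α)) ^ 2 ∨ (gap (polyFun α)) ^ 2 ≤ 2 ^ (n - 2)
  set good : Coeffs n → Prop := fun α =>
    (2 ^ (n - 1) ≤ (gap (polyFun α)) ^ 2 ∧
      (5 / 6) * ((2 : ℝ) ^ (n + 1))⁻¹ ≤ P (bar α) (delta α)) ∨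
    ((gap (polyFun α)) ^ 2 ≤ 2 ^ (n - 2) ∧
      P (bar α) (delta α) ≤ (2 / 3) * ((2 : ℝ) ^ (n + 1))⁻¹)
  change 1 - 60 * ε ≤ ((Finset.univ.filter fun α => prom α ∧ good α).card : ℝ) /
    (Finset.univ.filter prom).card
  have hpromCard : (Fintype.card (Coeffs n) : ℝ) ≤ 4 * (Finset.univ.filter prom).card := by
    have := card_le_four_mul_card_promise hn
    exact_mod_cast (by convert this)
  have hcard : (0 : ℝ) < Fintype.card (Coeffs n) := by exact_mod_cast Fintype.card_pos
  have hsplit : ((Finset.univ.filter prom).card : ℝ) =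
      (Finset.univ.filter fun α => prom α ∧ good α).card +
        (Finset.univ.filter fun α => prom α ∧ ¬ good α).card := by
    rw [← Finset.card_filter_add_card_filter_not good, Finset.filter_filter,
      Finset.filter_filter]
    push_cast
    rfl
  have hfail : ((Finset.univ.filter fun α => prom α ∧ ¬ good α).card : ℝ) ≤
      12 * (Fintype.card (Coeffs n) * ε) := by
    calc ((Finset.univ.filter fun α => prom α ∧ ¬ good α).card : ℝ)
        = ∑ α : Coeffs n with prom α ∧ ¬ good α, 1 := by simp
      _ ≤ ∑ α : Coeffs n with prom α ∧ ¬ good α,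
            12 * 2 ^ n * |P (bar α) (delta α) - Qtrue (bar α) (delta α)| := by
          refine Finset.sum_le_sum fun α hα => ?_
          obtain ⟨h1, h2⟩ := (Finset.mem_filter.1 hα).2
          exact one_le_mul_abs_sub_Qtrue hn α _ h1 h2
      _ ≤ ∑ α : Coeffs n, 12 * 2 ^ n * |P (bar α) (delta α) - Qtrue (bar α) (delta α)| :=
          Finset.sum_le_sum_of_subset_of_nonneg (Finset.filter_subset _ _)
            fun _ _ _ => by positivity
      _ = 12 * (2 ^ n * ∑ α : Coeffs n,
            |P (bar α) (delta α) - Qtrue (bar α) (delta α)|) := by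
          rw [← Finset.mul_sum, mul_assoc]
      _ ≤ 12 * (Fintype.card (Coeffs n) * ε) := by
          have := two_pow_mul_sum_bar_delta_le (fun β z => |P β z - Qtrue β z|) ε hP
          linarith
  rw [le_div_iff₀ (by linarith)]
  nlinarith [mul_le_mul_of_nonneg_right hpromCard hε]
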